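/- arXiv:2109.08883 — 3 statements merged into one kernel-verified Lean document; each statement's English description precedes it below -/
import Mathlib

section
/- Let (E,𝓑,m) be a σ-finite measure space, p ∈ (1,∞), p' = p/(p−1), let D₀* be a dense linear subspace of L^{p'}(m) and L₀* : D₀* → L^{p'}(m) a linear operator. Assume that for every T ∈ (0,∞) the linear span of the functions (s,x) ↦ f'(s)φ(x) + f(s)(L₀*φ)(x), where φ ∈ D₀* and f ∈ C¹([0,T];ℝ) with f(T) = 0, is dense in L^{p'}([0,T]×E, dt⊗m). Then any two strongly continuous semigroups (T_t)_{t≥0} and (T̃_t)_{t≥0} of bounded linear operators on L^p(m), each satisfying ∫ φ·(T_t u) dm = ∫ φ·u dm + ∫₀ᵗ ∫ (L₀*φ)·(T_s u) dm ds (and the same identity with T̃ in place of T) for all φ ∈ D₀*, all u ∈ L^p(m) and all t ≥ 0, coincide: T_t = T̃_t for all t ≥ 0. -/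
open MeasureTheory Set

noncomputable section

/-- A strongly continuous semigroup of bounded linear operators on a normed space. -/
def IsStrongSemigroup {X : Type*} [NormedAddCommGroup X] [NormedSpace ℝ X]
    (T : ℝ → X →L[ℝ] X) : Prop :=
  T 0 = ContinuousLinearMap.id ℝ X ∧
  (∀ s t : ℝ, 0 ≤ s → 0 ≤ t → T (s + t) = (T s).comp (T t)) ∧
  (∀ u : X, ContinuousOn (fun t => T t u) (Set.Ici (0 : ℝ)))

section Pairing

variable {α : Type*} [MeasurableSpace α] {m : Measure α} {p q : ENNReal}
  [Fact (1 ≤ p)] [Fact (1 ≤ q)]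

/-- The duality pairing `(ψ, v) ↦ ∫ ψ v dm` between `L^q` and `L^p` for conjugate exponents. -/
def dualPairing (m : Measure α) (p q : ENNReal) [Fact (1 ≤ p)] [Fact (1 ≤ q)]
    [q.HolderConjugate p] : Lp ℝ q m →L[ℝ] Lp ℝ p m →L[ℝ] ℝ :=
  (ContinuousLinearMap.mul ℝ ℝ).lpPairing m q p

lemma dualPairing_apply [q.HolderConjugate p] (ψ : Lp ℝ q m) (v : Lp ℝ p m) :
    dualPairing m p q ψ v = ∫ x, ψ x * v x ∂m := by
  simp [dualPairing, ContinuousLinearMap.lpPairing_eq_integral]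

lemma eq_zero_of_forall_dualPairing_eq_zero [q.HolderConjugate p] (hp : p ≠ ⊤)
    {v : Lp ℝ p m} (hv : ∀ ψ : Lp ℝ q m, dualPairing m p q ψ v = 0) : v = 0 := by
  have hp1 : (1 : ENNReal) ≤ p := Fact.out
  rw [Lp.eq_zero_iff_ae_eq_zero]
  refine Lp.ae_eq_zero_of_forall_setIntegral_eq_zero v (by positivity) hp ?_ ?_
  · intro s _ hs
    exact integrableOn_Lp_of_measure_ne_top v hp1 hs.ne
  · intro s hs hms
    have h := hv (indicatorConstLp q hs hms.ne (1 : ℝ))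
    rw [dualPairing_apply] at h
    rw [← h, ← integral_indicator hs]
    refine integral_congr_ae ?_
    filter_upwards [indicatorConstLp_coeFn (p := q) (hs := hs) (hμs := hms.ne) (c := (1 : ℝ))]
      with x hx
    rw [hx]
    by_cases hxs : x ∈ s <;> simp [hxs]

/-- An `L^q` function on a product has the same norm as the `L^q`-valued map of its sections. -/
lemma eLpNorm_eq_of_ae_sections {β : Type*} [MeasurableSpace β] {ν : Measure β} [SFinite ν]
    [SFinite m] (hq : q ≠ ⊤) (h : Lp ℝ q (ν.prod m)) (H : β → Lp ℝ q m)
    (hH : ∀ᵐ s ∂ν, ∀ᵐ x ∂m, h (s, x) = H s x) :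
    eLpNorm H q ν = ‖h‖ₑ := by
  have hq1 : (1 : ENNReal) ≤ q := Fact.out
  have hq0 : q ≠ 0 := by positivity
  have hr : q.toReal ≠ 0 := ENNReal.toReal_ne_zero.2 ⟨hq0, hq⟩
  rw [Lp.enorm_def, eLpNorm_eq_lintegral_rpow_enorm_toReal hq0 hq,
    eLpNorm_eq_lintegral_rpow_enorm_toReal hq0 hq,
    lintegral_prod _ ((Lp.aestronglyMeasurable h).enorm.pow_const _)]
  congr 1
  refine lintegral_congr_ae ?_
  filter_upwards [hH] with s hs
  rw [Lp.enorm_def, eLpNorm_eq_lintegral_rpow_enorm_toReal hq0 hq, one_div,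
    ENNReal.rpow_inv_rpow hr]
  refine lintegral_congr_ae ?_
  filter_upwards [hs] with x hx
  rw [hx]

/-- Integrating the sections of an `L^q` function against a bounded `L^p`-valued map is
controlled by the norm of the function. -/
lemma exists_norm_integral_dualPairing_le [q.HolderConjugate p] {β : Type*} [MeasurableSpace β]
    {ν : Measure β} [IsFiniteMeasure ν] [SFinite m] (hq : q ≠ ⊤) {w : β → Lp ℝ p m} {C : ℝ}
    (hw : ∀ᵐ s ∂ν, ‖w s‖ ≤ C) :
    ∃ K : ℝ, ∀ (h : Lp ℝ q (ν.prod m)) (H : β → Lp ℝ q m), AEStronglyMeasurable H ν →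
      (∀ᵐ s ∂ν, ∀ᵐ x ∂m, h (s, x) = H s x) →
      ‖∫ s, dualPairing m p q (H s) (w s) ∂ν‖ ≤ K * ‖h‖ := by
  have hq1 : (1 : ENNReal) ≤ q := Fact.out
  have hexp : 0 ≤ 1 / (1 : ENNReal).toReal - 1 / q.toReal := by
    have : 1 ≤ q.toReal := by
      simpa using ENNReal.toReal_mono hq hq1
    simpa using inv_le_one_of_one_le₀ this
  have hfin : ν univ ^ (1 / (1 : ENNReal).toReal - 1 / q.toReal) ≠ ⊤ :=
    ENNReal.rpow_ne_top_of_nonneg hexp (measure_ne_top _ _)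
  set r := ν univ ^ (1 / (1 : ENNReal).toReal - 1 / q.toReal)
  refine ⟨‖dualPairing m p q‖ * |C| * r.toReal, fun h H hHm hH => ?_⟩
  have hL1 : eLpNorm H 1 ν ≤ ‖h‖ₑ * r :=
    (eLpNorm_le_eLpNorm_mul_rpow_measure_univ hq1 hHm).trans_eq
      (by rw [eLpNorm_eq_of_ae_sections hq h H hH])
  have hint : Integrable H ν := by
    rw [← memLp_one_iff_integrable]
    exact ⟨hHm, hL1.trans_lt (ENNReal.mul_lt_top (by simp) hfin.lt_top)⟩
  have hL1' : ∫ s, ‖H s‖ ∂ν ≤ ‖h‖ * r.toReal := by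
    rw [integral_norm_eq_lintegral_enorm hHm, ← eLpNorm_one_eq_lintegral_enorm]
    refine (ENNReal.toReal_mono (ENNReal.mul_ne_top (by simp) hfin) hL1).trans_eq ?_
    simp [ENNReal.toReal_mul]
  calc ‖∫ s, dualPairing m p q (H s) (w s) ∂ν‖
      ≤ ∫ s, ‖dualPairing m p q‖ * |C| * ‖H s‖ ∂ν := by
        refine norm_integral_le_of_norm_le (hint.norm.const_mul _) ?_
        filter_upwards [hw] with s hs
        calc ‖dualPairing m p q (H s) (w s)‖
            ≤ ‖dualPairing m p q‖ * ‖H s‖ * ‖w s‖ := (dualPairing m p q).le_opNorm₂ _ _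
          _ ≤ ‖dualPairing m p q‖ * ‖H s‖ * |C| := by
              gcongr
              exact hs.trans (le_abs_self C)
          _ = ‖dualPairing m p q‖ * |C| * ‖H s‖ := by ring
    _ = ‖dualPairing m p q‖ * |C| * ∫ s, ‖H s‖ ∂ν := integral_const_mul _ _
    _ ≤ ‖dualPairing m p q‖ * |C| * (‖h‖ * r.toReal) := by gcongr
    _ = ‖dualPairing m p q‖ * |C| * r.toReal * ‖h‖ := by ring

/-- Integration by parts against a test function vanishing at the right end point. -/
lemma integral_deriv_mul_add_mul_eq_zero {τ : ℝ} (hτ : 0 ≤ τ) {f g k : ℝ → ℝ}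
    (hf : ContDiff ℝ 1 f) (hfτ : f τ = 0) (hk : Continuous k)
    (hg : ∀ t ∈ Icc 0 τ, g t = ∫ s in (0 : ℝ)..t, k s) :
    ∫ s in (0 : ℝ)..τ, (deriv f s * g s + f s * k s) = 0 := by
  have hG : ∀ t, HasDerivAt (fun t => ∫ s in (0 : ℝ)..t, k s) (k t) t := fun t =>
    intervalIntegral.integral_hasDerivAt_right (hk.intervalIntegrable _ _)
      hk.aestronglyMeasurable.stronglyMeasurableAtFilter hk.continuousAt
  have hparts := intervalIntegral.integral_deriv_mul_eq_sub (a := 0) (b := τ)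
    (fun x _ => ((hf.differentiable one_ne_zero) x).hasDerivAt) (fun x _ => hG x)
    ((hf.continuous_deriv le_rfl).intervalIntegrable _ _) (hk.intervalIntegrable _ _)
  rw [hfτ] at hparts
  simp only [intervalIntegral.integral_same, mul_zero, zero_mul, sub_zero] at hparts
  refine Eq.trans (intervalIntegral.integral_congr fun s hs => ?_) hparts
  rw [uIcc_of_le hτ] at hs
  simp only [hg s hs]

/-- A continuous `L^p`-valued curve annihilated by the adjoint parabolic operator vanishes,
provided the range of that operator is dense. -/
lemma eq_zero_of_parabolic_density [SigmaFinite m] [q.HolderConjugate p] (hp : p ≠ ⊤)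
    (hq : q ≠ ⊤) {D₀ : Submodule ℝ (Lp ℝ q m)} {L₀ : D₀ →ₗ[ℝ] Lp ℝ q m} {τ : ℝ} (hτ : 0 < τ)
    (hdense : Dense ((Submodule.span ℝ
        {h : Lp ℝ q ((volume.restrict (Set.Icc (0 : ℝ) τ)).prod m) |
          ∃ φ : D₀, ∃ f : ℝ → ℝ, ContDiff ℝ 1 f ∧ f τ = 0 ∧
            (h : ℝ × α → ℝ) =ᵐ[(volume.restrict (Set.Icc (0 : ℝ) τ)).prod m]
              fun z : ℝ × α =>
                deriv f z.1 * ((φ : Lp ℝ q m) : α → ℝ) z.2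
                  + f z.1 * (L₀ φ : α → ℝ) z.2} :
        Submodule ℝ (Lp ℝ q ((volume.restrict (Set.Icc (0 : ℝ) τ)).prod m))) :
        Set (Lp ℝ q ((volume.restrict (Set.Icc (0 : ℝ) τ)).prod m))))
    {w : ℝ → Lp ℝ p m} (hw : Continuous w)
    (hweak : ∀ φ : D₀, ∀ t ∈ Icc 0 τ, dualPairing m p q φ (w t)
      = ∫ s in (0 : ℝ)..t, dualPairing m p q (L₀ φ) (w s)) :
    ∀ t ∈ Icc 0 τ, w t = 0 := by
  set ν : Measure ℝ := volume.restrict (Icc 0 τ)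
  have hB : ∀ {H : ℝ → Lp ℝ q m}, Continuous H →
      Continuous fun s => dualPairing m p q (H s) (w s) := fun hH =>
    ((dualPairing m p q).continuous.comp hH).clm_apply hw
  have hInt : ∀ {g : ℝ → ℝ}, Continuous g → Integrable g ν := fun hg =>
    hg.continuousOn.integrableOn_Icc
  have hann : ∀ h ∈ Submodule.span ℝ
        {h : Lp ℝ q (ν.prod m) |
          ∃ φ : D₀, ∃ f : ℝ → ℝ, ContDiff ℝ 1 f ∧ f τ = 0 ∧
            (h : ℝ × α → ℝ) =ᵐ[ν.prod m] fun z : ℝ × α =>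
                deriv f z.1 * ((φ : Lp ℝ q m) : α → ℝ) z.2
                  + f z.1 * (L₀ φ : α → ℝ) z.2},
      ∃ H : ℝ → Lp ℝ q m, Continuous H ∧ (∀ᵐ s ∂ν, ∀ᵐ x ∂m, h (s, x) = H s x) ∧
        ∫ s, dualPairing m p q (H s) (w s) ∂ν = 0 := by
    intro h hh
    induction hh using Submodule.span_induction with
    | mem h hh =>
      obtain ⟨φ, f, hf, hfτ, hae⟩ := hh
      have hf' : Continuous (deriv f) := hf.continuous_deriv le_rfl
      refine ⟨fun s => deriv f s • (φ : Lp ℝ q m) + f s • L₀ φ,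
        (hf'.smul continuous_const).add (hf.continuous.smul continuous_const), ?_, ?_⟩
      · filter_upwards [Measure.ae_ae_of_ae_prod hae] with s hs
        filter_upwards [hs, Lp.coeFn_add (deriv f s • (φ : Lp ℝ q m)) (f s • L₀ φ),
          Lp.coeFn_smul (deriv f s) (φ : Lp ℝ q m), Lp.coeFn_smul (f s) (L₀ φ)]
          with x h1 h2 h3 h4
        rw [h1, h2, Pi.add_apply, h3, h4]
        simp
      · have := integral_deriv_mul_add_mul_eq_zero hτ.le hf hfτ
          (hB (continuous_const (y := L₀ φ))) (hweak φ)
        rw [intervalIntegral.integral_of_le hτ.le, ← integral_Icc_eq_integral_Ioc] at this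
        simpa using this
    | zero =>
      refine ⟨0, continuous_const, ?_, by simp⟩
      filter_upwards [Measure.ae_ae_of_ae_prod (Lp.coeFn_zero ℝ q (ν.prod m))] with s hs
      filter_upwards [hs, Lp.coeFn_zero ℝ q m] with x h1 h2
      exact h1.trans h2.symm
    | add h k _ _ ihh ihk =>
      obtain ⟨H, hHc, hH, hH0⟩ := ihh
      obtain ⟨K, hKc, hK, hK0⟩ := ihk
      refine ⟨fun s => H s + K s, hHc.add hKc, ?_, ?_⟩
      · filter_upwards [hH, hK, Measure.ae_ae_of_ae_prod (Lp.coeFn_add h k)] with s h1 h2 h3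
        filter_upwards [h1, h2, h3, Lp.coeFn_add (H s) (K s)] with x h1 h2 h3 h4
        rw [h3, h4, Pi.add_apply, Pi.add_apply, h1, h2]
      · simp only [map_add, add_apply]
        rw [integral_add (hInt (hB hHc)) (hInt (hB hKc)), hH0, hK0, add_zero]
    | smul a h _ ih =>
      obtain ⟨H, hHc, hH, hH0⟩ := ih
      refine ⟨fun s => a • H s, hHc.const_smul a, ?_, ?_⟩
      · filter_upwards [hH, Measure.ae_ae_of_ae_prod (Lp.coeFn_smul a h)] with s h1 h2
        filter_upwards [h1, h2, Lp.coeFn_smul a (H s)] with x h1 h2 h3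
        rw [h2, h3, Pi.smul_apply, Pi.smul_apply, h1]
      · simp only [map_smul, smul_apply]
        rw [integral_smul, hH0, smul_zero]
  intro t ht
  refine eq_zero_of_forall_dualPairing_eq_zero (q := q) hp fun ψ => ?_
  set c : ℝ → ℝ := fun s => dualPairing m p q ψ (w s)
  have hcc : Continuous c := hB continuous_const
  obtain ⟨Cw, hCw⟩ := isCompact_Icc.exists_bound_of_continuousOn (s := Icc 0 τ) hw.continuousOn
  obtain ⟨Cc, hCc⟩ := isCompact_Icc.exists_bound_of_continuousOn (s := Icc 0 τ) hcc.continuousOn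
  have hmem : ∀ᵐ s ∂ν, s ∈ Icc 0 τ := ae_restrict_mem measurableSet_Icc
  have hMem : MemLp (fun z : ℝ × α => c z.1 * ψ z.2) q (ν.prod m) := by
    refine ((Lp.memLp ψ).comp_snd ν).of_le_mul (c := Cc) ?_ ?_
    · exact (hcc.measurable.comp measurable_fst).aestronglyMeasurable.mul
        ((Lp.aestronglyMeasurable ψ).comp_snd)
    · filter_upwards [Measure.quasiMeasurePreserving_fst.ae hmem] with z hz
      rw [norm_mul]
      gcongr
      exact hCc _ hz
  obtain ⟨K, hK⟩ := exists_norm_integral_dualPairing_le (q := q) (ν := ν) hq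
    (w := w) (C := Cw) (hmem.mono hCw)
  have hest : ∀ h ∈ closure ((Submodule.span ℝ
        {h : Lp ℝ q (ν.prod m) |
          ∃ φ : D₀, ∃ f : ℝ → ℝ, ContDiff ℝ 1 f ∧ f τ = 0 ∧
            (h : ℝ × α → ℝ) =ᵐ[ν.prod m] fun z : ℝ × α =>
                deriv f z.1 * ((φ : Lp ℝ q m) : α → ℝ) z.2
                  + f z.1 * (L₀ φ : α → ℝ) z.2} : Submodule ℝ (Lp ℝ q (ν.prod m))) :
          Set (Lp ℝ q (ν.prod m))), ‖∫ s, c s ^ 2 ∂ν‖ ≤ K * ‖hMem.toLp - h‖ := by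
    refine closure_minimal (t := {h | ‖∫ s, c s ^ 2 ∂ν‖ ≤ K * ‖hMem.toLp - h‖}) ?_
      (isClosed_le (by fun_prop) (by fun_prop))
    intro h hh
    obtain ⟨H, hHc, hH, hH0⟩ := hann h hh
    have hcψ : Continuous fun s => c s • ψ := hcc.smul continuous_const
    have := hK (hMem.toLp - h) (fun s => c s • ψ - H s)
      (hcψ.sub hHc).aestronglyMeasurable ?_
    · simp only [map_sub, sub_apply] at this
      rw [integral_sub (hInt (hB hcψ)) (hInt (hB hHc)), hH0, sub_zero] at this
      simpa [pow_two, c] using this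
    · filter_upwards [hH, Measure.ae_ae_of_ae_prod (Lp.coeFn_sub hMem.toLp h),
        Measure.ae_ae_of_ae_prod hMem.coeFn_toLp] with s h1 h2 h3
      filter_upwards [h1, h2, h3, Lp.coeFn_sub (c s • ψ) (H s), Lp.coeFn_smul (c s) ψ]
        with x h1 h2 h3 h4 h5
      rw [h2, h4, Pi.sub_apply, Pi.sub_apply, h1, h3, h5]
      simp
  have hzero : ∫ s in (0 : ℝ)..τ, c s ^ 2 = 0 := by
    rw [intervalIntegral.integral_of_le hτ.le, ← integral_Icc_eq_integral_Ioc]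
    simpa using hest hMem.toLp (hdense _)
  by_contra hne
  refine (intervalIntegral.integral_pos hτ (hcc.pow 2).continuousOn
    (fun s _ => sq_nonneg (c s)) ⟨t, ht, ?_⟩).ne' hzero
  exact sq_pos_of_ne_zero hne

end Pairing

/-- Let `(E, 𝓑, m)` be σ-finite, `p ∈ (1, ∞)`, `p'` the conjugate exponent,
`D₀*` a dense subspace of `L^{p'}(m)` and `L₀* : D₀* → L^{p'}(m)` linear. If for every
`T ∈ (0, ∞)` the span of the functions `(s,x) ↦ f'(s)φ(x) + f(s)(L₀*φ)(x)` (with `φ ∈ D₀*`,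
`f` of class `C¹` with `f(T) = 0`) is dense in `L^{p'}([0,T] × E, dt ⊗ m)`, then any two
strongly continuous semigroups on `L^p(m)` satisfying the weak Kolmogorov identity
relative to `(L₀*, D₀*)` coincide. -/
theorem semigroup_uniqueness_of_parabolic_density
    {α : Type*} [MeasurableSpace α] (m : Measure α) [SigmaFinite m]
    (p q : ENNReal) [Fact (1 ≤ p)] [Fact (1 ≤ q)]
    (hp1 : 1 < p) (hptop : p ≠ ⊤) (hconj : p⁻¹ + q⁻¹ = 1)
    (D₀ : Submodule ℝ (Lp ℝ q m)) (hdense : Dense (D₀ : Set (Lp ℝ q m)))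
    (L₀ : D₀ →ₗ[ℝ] Lp ℝ q m)
    (hparab : ∀ T : ℝ, 0 < T →
      Dense ((Submodule.span ℝ
        {h : Lp ℝ q ((volume.restrict (Set.Icc (0 : ℝ) T)).prod m) |
          ∃ φ : D₀, ∃ f : ℝ → ℝ, ContDiff ℝ 1 f ∧ f T = 0 ∧
            (h : ℝ × α → ℝ) =ᵐ[(volume.restrict (Set.Icc (0 : ℝ) T)).prod m]
              fun z : ℝ × α =>
                deriv f z.1 * ((φ : Lp ℝ q m) : α → ℝ) z.2
                  + f z.1 * (L₀ φ : α → ℝ) z.2} :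
        Submodule ℝ (Lp ℝ q ((volume.restrict (Set.Icc (0 : ℝ) T)).prod m))) :
        Set (Lp ℝ q ((volume.restrict (Set.Icc (0 : ℝ) T)).prod m))))
    (T T' : ℝ → Lp ℝ p m →L[ℝ] Lp ℝ p m)
    (hT : IsStrongSemigroup T) (hT' : IsStrongSemigroup T')
    (hTweak : ∀ φ : D₀, ∀ u : Lp ℝ p m, ∀ t : ℝ, 0 ≤ t →
      ∫ x, ((φ : Lp ℝ q m) : α → ℝ) x * (T t u : α → ℝ) x ∂m
        = ∫ x, ((φ : Lp ℝ q m) : α → ℝ) x * (u : α → ℝ) x ∂m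
          + ∫ s in (0 : ℝ)..t, ∫ x, (L₀ φ : α → ℝ) x * (T s u : α → ℝ) x ∂m)
    (hT'weak : ∀ φ : D₀, ∀ u : Lp ℝ p m, ∀ t : ℝ, 0 ≤ t →
      ∫ x, ((φ : Lp ℝ q m) : α → ℝ) x * (T' t u : α → ℝ) x ∂m
        = ∫ x, ((φ : Lp ℝ q m) : α → ℝ) x * (u : α → ℝ) x ∂m
          + ∫ s in (0 : ℝ)..t, ∫ x, (L₀ φ : α → ℝ) x * (T' s u : α → ℝ) x ∂m) :
    ∀ t : ℝ, 0 ≤ t → T t = T' t := by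
  have : q.HolderConjugate p := ⟨by rw [add_comm, hconj, inv_one]⟩
  have hqtop : q ≠ ⊤ := by
    rintro rfl
    rw [ENNReal.inv_top, add_zero, ENNReal.inv_eq_one] at hconj
    exact hp1.ne' hconj
  intro t ht
  ext1 u
  have hcont : ∀ {S : ℝ → Lp ℝ p m →L[ℝ] Lp ℝ p m}, IsStrongSemigroup S →
      Continuous fun s => S (max s 0) u := fun hS =>
    (hS.2.2 u).comp_continuous (by fun_prop) fun s => le_max_right s 0
  have hweak : ∀ {S : ℝ → Lp ℝ p m →L[ℝ] Lp ℝ p m},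
      (∀ φ : D₀, ∀ u : Lp ℝ p m, ∀ t : ℝ, 0 ≤ t →
        ∫ x, ((φ : Lp ℝ q m) : α → ℝ) x * (S t u : α → ℝ) x ∂m
          = ∫ x, ((φ : Lp ℝ q m) : α → ℝ) x * (u : α → ℝ) x ∂m
            + ∫ s in (0 : ℝ)..t, ∫ x, (L₀ φ : α → ℝ) x * (S s u : α → ℝ) x ∂m) →
      ∀ φ : D₀, ∀ r : ℝ, 0 ≤ r → dualPairing m p q φ (S (max r 0) u)
        = dualPairing m p q φ u
          + ∫ s in (0 : ℝ)..r, dualPairing m p q (L₀ φ) (S (max s 0) u) := by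
    intro S hS φ r hr
    rw [max_eq_left hr, dualPairing_apply, dualPairing_apply, hS φ u r hr]
    congr 1
    refine intervalIntegral.integral_congr fun s hs => ?_
    rw [uIcc_of_le hr] at hs
    simp only [dualPairing_apply, max_eq_left hs.1]
  have key := eq_zero_of_parabolic_density (q := q) hptop hqtop (by positivity : 0 < t + 1)
    (hparab (t + 1) (by positivity))
    (w := fun s => T (max s 0) u - T' (max s 0) u) ((hcont hT).sub (hcont hT')) ?_ t ⟨ht, by linarith⟩
  · simp only [max_eq_left ht] at key
    exact sub_eq_zero.1 key
  · intro φ r hr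
    have hi : ∀ {S : ℝ → Lp ℝ p m →L[ℝ] Lp ℝ p m}, IsStrongSemigroup S →
        IntervalIntegrable (fun s => dualPairing m p q (L₀ φ) (S (max s 0) u)) volume 0 r :=
      fun hS => ((dualPairing m p q (L₀ φ)).continuous.comp (hcont hS)).intervalIntegrable _ _
    simp only [map_sub]
    rw [hweak hTweak φ r hr.1, hweak hT'weak φ r hr.1,
      intervalIntegral.integral_sub (hi hT) (hi hT'), add_sub_add_left_eq_sub]

end
end

section
/- Let (E,𝓑,m) be a σ-finite measure space, let D₀ be a dense linear subspace of L²(m) and L₀ : D₀ → L²(m) a symmetric linear operator with L₀(D₀) ⊂ L¹(m). Assume that for every T ∈ (0,∞) the linear span of the functions (s,x) ↦ f'(s)φ(x) + f(s)(L₀φ)(x), where φ ∈ D₀ and f ∈ C¹([0,T];ℝ) with f(T) = 0, is dense in L¹([0,T]×E, dt⊗m). Then any two strongly continuous semigroups (T_t)_{t≥0} and (T̃_t)_{t≥0} on L²(m), each consisting of self-adjoint sub-Markovian operators and each satisfying T_t φ = φ + ∫₀ᵗ T_s(L₀φ) ds (resp. T̃_t φ = φ + ∫₀ᵗ T̃_s(L₀φ)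 ds, Bochner integrals in L²(m)) for all φ ∈ D₀ and t ≥ 0, coincide: T_t = T̃_t for all t ≥ 0. -/
open MeasureTheory Set

noncomputable section

/-- Self-adjointness of a bounded operator on `L²(m)`, expressed via integrals. -/
def IsSelfAdjointOp {α : Type*} [MeasurableSpace α] (m : Measure α)
    (S : Lp ℝ 2 m →L[ℝ] Lp ℝ 2 m) : Prop :=
  ∀ v w : Lp ℝ 2 m, ∫ x, (S v : α → ℝ) x * (w : α → ℝ) x ∂m
    = ∫ x, (v : α → ℝ) x * (S w : α → ℝ) x ∂m

/-- A bounded linear operator `S` on `L²(m)` is sub-Markovian if `0 ≤ u ≤ 1` `m`-a.e.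
implies `0 ≤ S u ≤ 1` `m`-a.e. -/
def IsSubMarkovian {α : Type*} [MeasurableSpace α] (m : Measure α)
    (S : Lp ℝ 2 m →L[ℝ] Lp ℝ 2 m) : Prop :=
  ∀ u : Lp ℝ 2 m, (0 : α → ℝ) ≤ᵐ[m] u → (u : α → ℝ) ≤ᵐ[m] (1 : α → ℝ) →
    ((0 : α → ℝ) ≤ᵐ[m] S u ∧ (S u : α → ℝ) ≤ᵐ[m] (1 : α → ℝ))

/-- The integral pairing defining `IsSelfAdjointOp`, as the inner product of `L²(m)`. -/
lemma L2_inner_eq_integral_mul {α : Type*} [MeasurableSpace α] {m : Measure α}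
    (v w : Lp ℝ 2 m) :
    inner ℝ v w = ∫ x, (v : α → ℝ) x * (w : α → ℝ) x ∂m := by
  rw [L2.inner_def]
  refine integral_congr_ae (Filter.Eventually.of_forall fun x => ?_)
  simp [mul_comm]

lemma IsSelfAdjointOp.inner_apply_left {α : Type*} [MeasurableSpace α] {m : Measure α}
    {S : Lp ℝ 2 m →L[ℝ] Lp ℝ 2 m} (hS : IsSelfAdjointOp m S) (v w : Lp ℝ 2 m) :
    inner ℝ (S v) w = inner ℝ v (S w) := by
  rw [L2_inner_eq_integral_mul, L2_inner_eq_integral_mul, hS]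

/-- The `L¹`-`L^∞` Hölder inequality for `L²` functions. -/
lemma abs_L2_inner_le_integral_abs {α : Type*} [MeasurableSpace α] {m : Measure α}
    {k v : Lp ℝ 2 m} (hk : Integrable k m) (hv : ∀ᵐ x ∂m, |(v : α → ℝ) x| ≤ 1) :
    |inner ℝ k v| ≤ ∫ x, |(k : α → ℝ) x| ∂m := by
  rw [L2_inner_eq_integral_mul, ← Real.norm_eq_abs]
  refine norm_integral_le_of_norm_le hk.abs ?_
  filter_upwards [hv] with x hx
  rw [Real.norm_eq_abs, abs_mul]
  exact mul_le_of_le_one_right (abs_nonneg _) hx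

/-- The weak form of the evolution equation for a self-adjoint semigroup. -/
lemma IsStrongSemigroup.inner_apply_eq_add_integral {α : Type*} [MeasurableSpace α]
    {m : Measure α} {T : ℝ → Lp ℝ 2 m →L[ℝ] Lp ℝ 2 m} (hT : IsStrongSemigroup T)
    (hsa : ∀ t : ℝ, 0 ≤ t → IsSelfAdjointOp m (T t)) {φ η : Lp ℝ 2 m} {t : ℝ} (ht : 0 ≤ t)
    (hgen : T t φ = φ + ∫ s in (0 : ℝ)..t, T s η) (u : Lp ℝ 2 m) :
    inner ℝ φ (T t u) = inner ℝ φ u + ∫ s in (0 : ℝ)..t, inner ℝ η (T s u) := by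
  have hint : IntervalIntegrable (fun s => T s η) volume 0 t := by
    refine ((hT.2.2 η).mono ?_).intervalIntegrable
    rw [uIcc_of_le ht]
    exact Icc_subset_Ici_self
  rw [← (hsa t ht).inner_apply_left, hgen, inner_add_left]
  congr 1
  have h := (innerSL ℝ u).intervalIntegral_comp_comm hint
  simp only [innerSL_apply_apply] at h
  rw [real_inner_comm, ← h]
  refine intervalIntegral.integral_congr fun s hs => ?_
  rw [uIcc_of_le ht] at hs
  rw [real_inner_comm, (hsa s hs.1).inner_apply_left]

/-- Testing a weak solution of the evolution equation with zero initial value against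
`f ⊗ φ`, where `f` vanishes at the final time. -/
lemma integral_inner_deriv_smul_add_smul_eq_zero {H : Type*} [NormedAddCommGroup H]
    [InnerProductSpace ℝ H] {V : ℝ → H} (hV : Continuous V) {φ η : H}
    (hweak : ∀ s : ℝ, 0 ≤ s → inner ℝ φ (V s) = ∫ r in (0 : ℝ)..s, inner ℝ η (V r))
    {f : ℝ → ℝ} (hf : ContDiff ℝ 1 f) {t : ℝ} (ht : 0 ≤ t) (hft : f t = 0) :
    ∫ s in (0 : ℝ)..t, inner ℝ (deriv f s • φ + f s • η) (V s) = 0 := by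
  have hη : Continuous fun r => inner ℝ η (V r) := continuous_const.inner hV
  have hparts := intervalIntegral.integral_deriv_mul_eq_sub (a := 0) (b := t)
    (u := f) (v := fun s => ∫ r in (0 : ℝ)..s, inner ℝ η (V r))
    (u' := deriv f) (v' := fun s => inner ℝ η (V s))
    (fun s _ => (hf.differentiable_one s).hasDerivAt)
    (fun s _ => (hη.integral_hasStrictDerivAt 0 s).hasDerivAt)
    ((hf.continuous_deriv le_rfl).intervalIntegrable _ _) (hη.intervalIntegrable _ _)
  simp only [hft, intervalIntegral.integral_same, zero_mul, mul_zero, sub_zero] at hparts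
  refine (intervalIntegral.integral_congr fun s hs => ?_).trans hparts
  rw [uIcc_of_le ht] at hs
  simp only [inner_add_left, real_inner_smul_left, hweak s hs.1]

/-- Elements of the span of the parabolic test functions are represented by curves in `L²(m)`
that annihilate every weak solution with zero initial value. -/
lemma exists_L2_curve_of_mem_span {α : Type*} [MeasurableSpace α] {m : Measure α} [SigmaFinite m]
    {D₀ : Submodule ℝ (Lp ℝ 2 m)} {L₀ : D₀ →ₗ[ℝ] Lp ℝ 2 m}
    {V : ℝ → Lp ℝ 2 m} (hV : Continuous V)
    (hweak : ∀ φ : D₀, ∀ s : ℝ, 0 ≤ s →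
      inner ℝ (φ : Lp ℝ 2 m) (V s) = ∫ r in (0 : ℝ)..s, inner ℝ (L₀ φ) (V r))
    {t : ℝ} (ht : 0 ≤ t) {w : Lp ℝ 1 ((volume.restrict (Icc (0 : ℝ) t)).prod m)}
    (hw : w ∈ Submodule.span ℝ
        {h : Lp ℝ 1 ((volume.restrict (Icc (0 : ℝ) t)).prod m) |
          ∃ φ : D₀, ∃ f : ℝ → ℝ, ContDiff ℝ 1 f ∧ f t = 0 ∧
            (h : ℝ × α → ℝ) =ᵐ[(volume.restrict (Icc (0 : ℝ) t)).prod m]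
              fun z : ℝ × α =>
                deriv f z.1 * ((φ : Lp ℝ 2 m) : α → ℝ) z.2
                  + f z.1 * (L₀ φ : α → ℝ) z.2}) :
    ∃ k : ℝ → Lp ℝ 2 m,
      (∀ᵐ s ∂(volume.restrict (Icc (0 : ℝ) t)), ∀ᵐ x ∂m, w (s, x) = k s x) ∧
      IntervalIntegrable (fun s => inner ℝ (k s) (V s)) volume 0 t ∧
      ∫ s in (0 : ℝ)..t, inner ℝ (k s) (V s) = 0 := by
  induction hw using Submodule.span_induction with
  | mem h hh =>
    obtain ⟨φ, f, hf, hft, hae⟩ := hh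
    refine ⟨fun s => deriv f s • (φ : Lp ℝ 2 m) + f s • L₀ φ, ?_, ?_, ?_⟩
    · filter_upwards [Measure.ae_ae_of_ae_prod hae] with s hs
      filter_upwards [hs, Lp.coeFn_add (deriv f s • (φ : Lp ℝ 2 m)) (f s • L₀ φ),
        Lp.coeFn_smul (deriv f s) (φ : Lp ℝ 2 m), Lp.coeFn_smul (f s) (L₀ φ)] with x h1 h2 h3 h4
      rw [h1, h2, Pi.add_apply, h3, h4, Pi.smul_apply, Pi.smul_apply, smul_eq_mul, smul_eq_mul]
    · refine Continuous.intervalIntegrable ?_ _ _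
      exact ((((hf.continuous_deriv le_rfl).smul continuous_const).add
        (hf.continuous.smul continuous_const)).inner hV)
    · exact integral_inner_deriv_smul_add_smul_eq_zero hV (hweak φ) hf ht hft
  | zero =>
    refine ⟨0, ?_, by simp, by simp⟩
    filter_upwards [Measure.ae_ae_of_ae_prod
      (Lp.coeFn_zero ℝ 1 ((volume.restrict (Icc (0 : ℝ) t)).prod m))] with s hs
    filter_upwards [hs, Lp.coeFn_zero ℝ 2 m] with x h1 h2
    simp only [Pi.zero_apply] at h1 h2 ⊢
    rw [h1, h2]
  | add y z _ _ hy hz =>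
    obtain ⟨k, hk, hki, hk0⟩ := hy
    obtain ⟨l, hl, hli, hl0⟩ := hz
    refine ⟨k + l, ?_, ?_, ?_⟩
    · filter_upwards [hk, hl, Measure.ae_ae_of_ae_prod (Lp.coeFn_add y z)] with s h1 h2 h3
      filter_upwards [h1, h2, h3, Lp.coeFn_add (k s) (l s)] with x h1 h2 h3 h4
      rw [h3, Pi.add_apply, h1, h2, Pi.add_apply, h4, Pi.add_apply]
    · simpa only [Pi.add_apply, inner_add_left] using hki.add hli
    · simp only [Pi.add_apply, inner_add_left]
      rw [intervalIntegral.integral_add hki hli, hk0, hl0, add_zero]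
  | smul c y _ hy =>
    obtain ⟨k, hk, hki, hk0⟩ := hy
    refine ⟨c • k, ?_, ?_, ?_⟩
    · filter_upwards [hk, Measure.ae_ae_of_ae_prod (Lp.coeFn_smul c y)] with s h1 h2
      filter_upwards [h1, h2, Lp.coeFn_smul c (k s)] with x h1 h2 h3
      simp [h1, h2, h3]
    · simpa only [Pi.smul_apply, real_inner_smul_left] using hki.const_mul c
    · simp only [Pi.smul_apply, real_inner_smul_left]
      rw [intervalIntegral.integral_const_mul, hk0, mul_zero]

/-- If `w` is represented by a curve `k` in `L²(m)` that annihilates the bounded curve `V`, then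
the time integral of `⟪ψ, V s⟫` is at most the `L¹` distance of `w` to the constant curve `ψ`. -/
lemma abs_integral_inner_le_norm_sub {α : Type*} [MeasurableSpace α] {m : Measure α}
    [SigmaFinite m] {V : ℝ → Lp ℝ 2 m} (hV : Continuous V)
    (hbound : ∀ s, ∀ᵐ x ∂m, |(V s : α → ℝ) x| ≤ 1) {t : ℝ} (ht : 0 ≤ t) {ψ : Lp ℝ 2 m}
    {h w : Lp ℝ 1 ((volume.restrict (Icc (0 : ℝ) t)).prod m)}
    (hh : (h : ℝ × α → ℝ) =ᵐ[(volume.restrict (Icc (0 : ℝ) t)).prod m] fun z => ψ z.2)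
    {k : ℝ → Lp ℝ 2 m}
    (hk : ∀ᵐ s ∂(volume.restrict (Icc (0 : ℝ) t)), ∀ᵐ x ∂m, w (s, x) = k s x)
    (hki : IntervalIntegrable (fun s => inner ℝ (k s) (V s)) volume 0 t)
    (hk0 : ∫ s in (0 : ℝ)..t, inner ℝ (k s) (V s) = 0) :
    |∫ s in (0 : ℝ)..t, inner ℝ ψ (V s)| ≤ ‖h - w‖ := by
  have hψi : IntervalIntegrable (fun s => inner ℝ ψ (V s)) volume 0 t :=
    (continuous_const.inner hV).intervalIntegrable _ _
  have hdiff : ∫ s in (0 : ℝ)..t, inner ℝ ψ (V s)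
      = ∫ s in Icc (0 : ℝ) t, inner ℝ (ψ - k s) (V s) := by
    rw [integral_Icc_eq_integral_Ioc, ← intervalIntegral.integral_of_le ht]
    simp only [inner_sub_left]
    rw [intervalIntegral.integral_sub hψi hki, hk0, sub_zero]
  have hint : Integrable (h - w : Lp ℝ 1 ((volume.restrict (Icc (0 : ℝ) t)).prod m))
      ((volume.restrict (Icc (0 : ℝ) t)).prod m) := L1.integrable_coeFn _
  rw [hdiff, L1.norm_eq_integral_norm, integral_prod _ hint.norm, ← Real.norm_eq_abs]
  refine norm_integral_le_of_norm_le hint.integral_norm_prod_left ?_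
  filter_upwards [hk, Measure.ae_ae_of_ae_prod hh, Measure.ae_ae_of_ae_prod (Lp.coeFn_sub h w),
    hint.prod_right_ae] with s h1 h2 h3 h4
  have hae : (fun x => (h - w : Lp ℝ 1 ((volume.restrict (Icc (0 : ℝ) t)).prod m)) (s, x))
      =ᵐ[m] (ψ - k s : Lp ℝ 2 m) := by
    filter_upwards [h1, h2, h3, Lp.coeFn_sub ψ (k s)] with x h1 h2 h3 h4
    rw [h3, Pi.sub_apply, h1, h2, h4, Pi.sub_apply]
  refine (abs_L2_inner_le_integral_abs (h4.congr hae) (hbound s)).trans_eq ?_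
  refine integral_congr_ae ?_
  filter_upwards [hae] with x hx
  rw [← hx, Real.norm_eq_abs]

/-- Two sub-Markovian operators applied to a function with values in `[0, 1]` differ by at
most `1`. -/
lemma IsSubMarkovian.abs_sub_le_one {α : Type*} [MeasurableSpace α] {m : Measure α}
    {S S' : Lp ℝ 2 m →L[ℝ] Lp ℝ 2 m} (hS : IsSubMarkovian m S) (hS' : IsSubMarkovian m S')
    {u : Lp ℝ 2 m} (hu0 : (0 : α → ℝ) ≤ᵐ[m] u) (hu1 : (u : α → ℝ) ≤ᵐ[m] (1 : α → ℝ)) :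
    ∀ᵐ x ∂m, |(S u - S' u : Lp ℝ 2 m) x| ≤ 1 := by
  filter_upwards [(hS u hu0 hu1).1, (hS u hu0 hu1).2, (hS' u hu0 hu1).1, (hS' u hu0 hu1).2,
    Lp.coeFn_sub (S u) (S' u)] with x h1 h2 h3 h4 h5
  simp only [Pi.zero_apply, Pi.one_apply] at h1 h2 h3 h4
  rw [h5, Pi.sub_apply, abs_le]
  constructor <;> linarith

/-- A continuous curve whose primitives over `[0, t]`, `t > 0`, vanish is zero on `[0, ∞)`. -/
lemma eq_zero_of_forall_intervalIntegral_eq_zero {g : ℝ → ℝ} (hg : Continuous g)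
    (h : ∀ t : ℝ, 0 < t → ∫ s in (0 : ℝ)..t, g s = 0) {t : ℝ} (ht : 0 ≤ t) : g t = 0 := by
  have hpos : ∀ t : ℝ, 0 < t → g t = 0 := by
    intro t ht
    have hd := (hg.integral_hasStrictDerivAt 0 t).hasDerivAt
    refine hd.unique ((hasDerivAt_const t (0 : ℝ)).congr_of_eventuallyEq ?_)
    filter_upwards [lt_mem_nhds ht] with s hs using h s hs
  have hcl : closure (Ioi (0 : ℝ)) ⊆ {t | g t = 0} :=
    closure_minimal (fun t ht => hpos t ht) (isClosed_eq hg continuous_const)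
  rw [closure_Ioi] at hcl
  exact hcl ht

/-- Two bounded operators on `L²(m)` that agree on indicators of sets of finite measure
coincide. -/
lemma L2_clm_ext_indicator {α : Type*} [MeasurableSpace α] {m : Measure α}
    {S S' : Lp ℝ 2 m →L[ℝ] Lp ℝ 2 m}
    (h : ∀ (A : Set α) (hA : MeasurableSet A) (hmA : m A ≠ ⊤),
      S (indicatorConstLp 2 hA hmA 1) = S' (indicatorConstLp 2 hA hmA 1)) : S = S' := by
  ext1 u
  induction u using Lp.induction (p := 2) ENNReal.ofNat_ne_top with
  | @indicatorConst c A hA hmA =>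
    rw [Lp.simpleFunc.coe_indicatorConst]
    have hc : indicatorConstLp 2 hA hmA.ne c = c • indicatorConstLp 2 hA hmA.ne (1 : ℝ) := by
      refine Lp.ext ?_
      filter_upwards [indicatorConstLp_coeFn (p := 2) (hs := hA) (hμs := hmA.ne) (c := c),
        indicatorConstLp_coeFn (p := 2) (hs := hA) (hμs := hmA.ne) (c := (1 : ℝ)),
        Lp.coeFn_smul c (indicatorConstLp 2 hA hmA.ne (1 : ℝ))] with x h1 h2 h3
      rw [h1, h3, Pi.smul_apply, h2]
      by_cases hx : x ∈ A <;> simp [hx]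
    rw [hc, map_smul, map_smul, h A hA hmA.ne]
  | add hf hg _ hf' hg' => rw [map_add, map_add, hf', hg']
  | isClosed => exact isClosed_eq (by fun_prop) (by fun_prop)

/-- Let `(E, 𝓑, m)` be σ-finite, `D₀` a dense subspace of `L²(m)`,
`L₀ : D₀ → L²(m)` symmetric with `L₀(D₀) ⊂ L¹(m)`. If for every `T ∈ (0, ∞)` the span of
`(s,x) ↦ f'(s)φ(x) + f(s)(L₀φ)(x)` (with `φ ∈ D₀`, `f` of class `C¹`, `f(T) = 0`) is dense
in `L¹([0,T] × E, dt ⊗ m)`, then any two strongly continuous semigroups of self-adjoint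
sub-Markovian operators on `L²(m)` whose generators extend `(L₀, D₀)` coincide. -/
theorem subMarkovian_semigroup_uniqueness_of_L1_parabolic_density
    {α : Type*} [MeasurableSpace α] (m : Measure α) [SigmaFinite m]
    (D₀ : Submodule ℝ (Lp ℝ 2 m)) (hdense : Dense (D₀ : Set (Lp ℝ 2 m)))
    (L₀ : D₀ →ₗ[ℝ] Lp ℝ 2 m)
    (hsymm : ∀ φ ψ : D₀,
      ∫ x, (L₀ φ : α → ℝ) x * ((ψ : Lp ℝ 2 m) : α → ℝ) x ∂m
        = ∫ x, ((φ : Lp ℝ 2 m) : α → ℝ) x * (L₀ ψ : α → ℝ) x ∂m)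
    (hL1 : ∀ φ : D₀, Integrable (L₀ φ : α → ℝ) m)
    (hparab : ∀ T : ℝ, 0 < T →
      Dense ((Submodule.span ℝ
        {h : Lp ℝ 1 ((volume.restrict (Set.Icc (0 : ℝ) T)).prod m) |
          ∃ φ : D₀, ∃ f : ℝ → ℝ, ContDiff ℝ 1 f ∧ f T = 0 ∧
            (h : ℝ × α → ℝ) =ᵐ[(volume.restrict (Set.Icc (0 : ℝ) T)).prod m]
              fun z : ℝ × α =>
                deriv f z.1 * ((φ : Lp ℝ 2 m) : α → ℝ) z.2
                  + f z.1 * (L₀ φ : α → ℝ) z.2} :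
        Submodule ℝ (Lp ℝ 1 ((volume.restrict (Set.Icc (0 : ℝ) T)).prod m))) :
        Set (Lp ℝ 1 ((volume.restrict (Set.Icc (0 : ℝ) T)).prod m))))
    (T T' : ℝ → Lp ℝ 2 m →L[ℝ] Lp ℝ 2 m)
    (hT : IsStrongSemigroup T) (hT' : IsStrongSemigroup T')
    (hTsa : ∀ t : ℝ, 0 ≤ t → IsSelfAdjointOp m (T t))
    (hT'sa : ∀ t : ℝ, 0 ≤ t → IsSelfAdjointOp m (T' t))
    (hTsm : ∀ t : ℝ, 0 ≤ t → IsSubMarkovian m (T t))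
    (hT'sm : ∀ t : ℝ, 0 ≤ t → IsSubMarkovian m (T' t))
    (hTgen : ∀ φ : D₀, ∀ t : ℝ, 0 ≤ t →
      T t (φ : Lp ℝ 2 m) = (φ : Lp ℝ 2 m) + ∫ s in (0 : ℝ)..t, T s (L₀ φ))
    (hT'gen : ∀ φ : D₀, ∀ t : ℝ, 0 ≤ t →
      T' t (φ : Lp ℝ 2 m) = (φ : Lp ℝ 2 m) + ∫ s in (0 : ℝ)..t, T' s (L₀ φ)) :
    ∀ t : ℝ, 0 ≤ t → T t = T' t := by
  intro t ht
  refine L2_clm_ext_indicator fun A hA hmA => ?_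
  set u : Lp ℝ 2 m := indicatorConstLp 2 hA hmA 1 with hu
  have hu0 : (0 : α → ℝ) ≤ᵐ[m] u := by
    filter_upwards [indicatorConstLp_coeFn (p := 2) (hs := hA) (hμs := hmA) (c := (1 : ℝ))]
      with x hx
    rw [hu, hx]
    exact indicator_nonneg (fun _ _ => zero_le_one) x
  have hu1 : (u : α → ℝ) ≤ᵐ[m] (1 : α → ℝ) := by
    filter_upwards [indicatorConstLp_coeFn (p := 2) (hs := hA) (hμs := hmA) (c := (1 : ℝ))]
      with x hx
    rw [hu, hx]
    exact indicator_le_self' (fun _ _ => zero_le_one) x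
  have hmax : Continuous fun s : ℝ => max s 0 := continuous_id.max continuous_const
  let V : ℝ → Lp ℝ 2 m := fun s => T (max s 0) u - T' (max s 0) u
  have hVeq : ∀ s, 0 ≤ s → V s = T s u - T' s u := fun s hs => by simp only [V, max_eq_left hs]
  have hV : Continuous V :=
    ((hT.2.2 u).comp_continuous hmax fun s => le_max_right s 0).sub
      ((hT'.2.2 u).comp_continuous hmax fun s => le_max_right s 0)
  have hbound : ∀ s, ∀ᵐ x ∂m, |(V s : α → ℝ) x| ≤ 1 := fun s =>
    (hTsm _ (le_max_right s 0)).abs_sub_le_one (hT'sm _ (le_max_right s 0)) hu0 hu1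
  have hweak : ∀ φ : D₀, ∀ s : ℝ, 0 ≤ s →
      inner ℝ (φ : Lp ℝ 2 m) (V s) = ∫ r in (0 : ℝ)..s, inner ℝ (L₀ φ) (V r) := by
    intro φ s hs
    have hint : ∀ S : ℝ → Lp ℝ 2 m →L[ℝ] Lp ℝ 2 m, IsStrongSemigroup S →
        IntervalIntegrable (fun r => inner ℝ (L₀ φ) (S r u)) volume 0 s := by
      intro S hS
      refine (continuousOn_const.inner ((hS.2.2 u).mono ?_)).intervalIntegrable
      rw [uIcc_of_le hs]
      exact Icc_subset_Ici_self
    rw [hVeq s hs, inner_sub_right,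
      hT.inner_apply_eq_add_integral hTsa hs (hTgen φ s hs),
      hT'.inner_apply_eq_add_integral hT'sa hs (hT'gen φ s hs), add_sub_add_left_eq_sub,
      ← intervalIntegral.integral_sub (hint T hT) (hint T' hT')]
    refine intervalIntegral.integral_congr fun r hr => ?_
    rw [uIcc_of_le hs] at hr
    simp only [hVeq r hr.1, inner_sub_right]
  have hzero : ∀ ψ : Lp ℝ 2 m, Integrable ψ m → inner ℝ ψ (V t) = 0 := by
    intro ψ hψ
    refine eq_zero_of_forall_intervalIntegral_eq_zero
      (g := fun s => inner ℝ ψ (V s)) (continuous_const.inner hV) (fun τ hτ => ?_) ht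
    have hψ' : Integrable (fun z : ℝ × α => (ψ : α → ℝ) z.2)
        ((volume.restrict (Icc (0 : ℝ) τ)).prod m) := hψ.comp_snd _
    refine abs_nonpos_iff.mp (le_of_forall_pos_le_add fun ε hε => ?_)
    obtain ⟨w, hw, hdist⟩ := (hparab τ hτ).exists_dist_lt hψ'.toL1 hε
    obtain ⟨k, hk, hki, hk0⟩ := exists_L2_curve_of_mem_span hV hweak hτ.le hw
    rw [zero_add]
    refine (abs_integral_inner_le_norm_sub hV hbound hτ.le hψ'.coeFn_toL1 hk hki hk0).trans ?_
    rw [← dist_eq_norm]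
    exact hdist.le
  rw [← sub_eq_zero, ← hVeq t ht]
  refine Lp.ext ((Lp.ae_eq_zero_of_forall_setIntegral_eq_zero (V t) two_ne_zero (by norm_num)
    (fun B _ hmB => ?_) (fun B hB hmB => ?_)).trans (Lp.coeFn_zero ℝ 2 m).symm)
  · exact integrableOn_Lp_of_measure_ne_top _ (by norm_num) hmB.ne
  · rw [← L2.inner_indicatorConstLp_one hB hmB.ne]
    refine hzero _ ?_
    exact (integrable_indicatorConstLp hB hmB.ne 1)

end
end

section
/- Let d ∈ ℕ, ρ ∈ L¹_loc(ℝ^d,dx) with ρ > 0 dx-a.e., and suppose assumption (A) holds. Then for all φ, ψ ∈ C_c^∞(ℝ^d): ∫ ψ·(L₀φ)·ρ dx = −∫ ⟨A∇ψ, ∇φ⟩ ρ dx + ∫ c·ψ·φ·ρ dx. In particular ∫ ψ·(L₀φ)·ρ dx = ∫ φ·(L₀ψ)·ρ dx (so (L₀, C_c^∞(ℝ^d)) is symmetric on L²(ℝ^d, ρ dx)) and −∫ φ·(L₀φ)·ρ dx ≥ 0. -/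
open MeasureTheory Set

noncomputable section

/-- Euclidean space `ℝ^d`. -/
abbrev Rd (d : ℕ) := EuclideanSpace ℝ (Fin d)

/-- First partial derivative `∂_{x_i} φ`. -/
def pd {d : ℕ} (i : Fin d) (φ : Rd d → ℝ) (x : Rd d) : ℝ :=
  fderiv ℝ φ x (EuclideanSpace.single i 1)

/-- Second partial derivative `∂_{x_i} ∂_{x_j} φ`. -/
def pd2 {d : ℕ} (i j : Fin d) (φ : Rd d → ℝ) (x : Rd d) : ℝ :=
  fderiv ℝ (fun y => fderiv ℝ φ y (EuclideanSpace.single j 1)) x (EuclideanSpace.single i 1)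

/-- `C_c^∞` test functions on `ℝ^d`. -/
def IsTest {d : ℕ} (φ : Rd d → ℝ) : Prop :=
  ContDiff ℝ (⊤ : ℕ∞) φ ∧ HasCompactSupport φ

/-- `h` is the weak partial derivative `∂_{x_i} g` (both locally integrable). -/
def HasWeakPartialDeriv {d : ℕ} (i : Fin d) (g h : Rd d → ℝ) : Prop :=
  LocallyIntegrable g volume ∧ LocallyIntegrable h volume ∧
  ∀ φ : Rd d → ℝ, IsTest φ → ∫ x, g x * pd i φ x = - ∫ x, h x * φ x

/-- The measure `ρ dx` on `ℝ^d`. -/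
def rhoMeasure {d : ℕ} (ρ : Rd d → ℝ) : Measure (Rd d) :=
  volume.withDensity fun x => ENNReal.ofReal (ρ x)

/-- `g ∈ L²_loc(ℝ^d, m)`. -/
def MemL2loc {d : ℕ} (m : Measure (Rd d)) (g : Rd d → ℝ) : Prop :=
  ∀ R : ℝ, 0 < R → ∫⁻ x in Metric.ball (0 : Rd d) R, ENNReal.ofReal (g x ^ 2) ∂m < ⊤

/-- Assumption (A): measurability, `c ≤ 0`, symmetry and nonnegative definiteness of
`A = (a^{ij})`, `a^{ij} ∈ W^{1,1}_loc ∩ L²_loc(ρ dx)`, `c, ∂_{x_i}a^{ij} ∈ L²_loc(ρ dx)`,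
`ρ^{1/2} ∈ W^{1,1}_loc` (with weak partials `dsq i`), and
`a^{ij} ρ^{-1/2} ∂_{x_i}ρ^{1/2} ∈ L²_loc(ρ dx)`. -/
def AssumptionA {d : ℕ} (a : Fin d → Fin d → Rd d → ℝ)
    (da : Fin d → Fin d → Fin d → Rd d → ℝ) (c : Rd d → ℝ)
    (ρ : Rd d → ℝ) (dsq : Fin d → Rd d → ℝ) : Prop :=
  (∀ i j, Measurable (a i j)) ∧ Measurable c ∧ (∀ x, c x ≤ 0) ∧
  (∀ i j x, a i j x = a j i x) ∧
  (∀ x : Rd d, ∀ ξ : Fin d → ℝ, 0 ≤ ∑ i, ∑ j, ξ i * a i j x * ξ j) ∧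
  (∀ i j k, HasWeakPartialDeriv k (a i j) (da i j k)) ∧
  (∀ i j, MemL2loc (rhoMeasure ρ) (a i j)) ∧
  MemL2loc (rhoMeasure ρ) c ∧
  (∀ i j, MemL2loc (rhoMeasure ρ) (da i j i)) ∧
  (∀ i, HasWeakPartialDeriv i (fun x => Real.sqrt (ρ x)) (dsq i)) ∧
  (∀ i j, MemL2loc (rhoMeasure ρ) fun x => a i j x * (dsq i x / Real.sqrt (ρ x)))

/-- The operator `L₀φ = a^{ij}∂_i∂_jφ + (∂_i a^{ij})∂_jφ
+ 2ρ^{-1/2}(∂_i ρ^{1/2}) a^{ij} ∂_jφ + cφ` (Einstein summation). -/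
def L0A {d : ℕ} (a : Fin d → Fin d → Rd d → ℝ)
    (da : Fin d → Fin d → Fin d → Rd d → ℝ) (c : Rd d → ℝ)
    (ρ : Rd d → ℝ) (dsq : Fin d → Rd d → ℝ) (φ : Rd d → ℝ) (x : Rd d) : ℝ :=
  (∑ i, ∑ j, a i j x * pd2 i j φ x)
    + (∑ i, ∑ j, da i j i x * pd j φ x)
    + (2 * ∑ i, ∑ j, (dsq i x / Real.sqrt (ρ x)) * a i j x * pd j φ x)
    + c x * φ x

lemma locallyIntegrable_comp_snd {X : Type*} [TopologicalSpace X] [MeasurableSpace X]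
    {μ : Measure X} [SFinite μ] {f : X → ℝ} (hf : LocallyIntegrable f μ) :
    LocallyIntegrable (fun p : ℝ × X => f p.2) ((volume : Measure ℝ).prod μ) := by
  rintro ⟨t, x⟩
  obtain ⟨s, hs, hfs⟩ := hf x
  refine ⟨Metric.closedBall t 1 ×ˢ s, prod_mem_nhds (Metric.closedBall_mem_nhds t one_pos) hs, ?_⟩
  rw [IntegrableOn, ← Measure.prod_restrict]
  have : IsFiniteMeasure ((volume : Measure ℝ).restrict (Metric.closedBall t 1)) :=
    ⟨by simp⟩
  exact Integrable.comp_snd hfs _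

lemma measurePreserving_shear {d : ℕ} (e : Rd d) :
    MeasurePreserving (fun p : ℝ × Rd d => (p.1, p.2 + p.1 • e)) volume volume := by
  refine MeasurePreserving.skew_product (MeasurePreserving.id _)
    (g := fun (t : ℝ) (x : Rd d) => x + t • e) ?_ (.of_forall fun t => ?_)
  · exact Continuous.measurable (by fun_prop)
  · exact (measurePreserving_add_right volume (t • e)).map_eq

/-- The shear `(t, x) ↦ (t, x + t e)` of `ℝ × ℝ^d`. -/
def shear {d : ℕ} (e : Rd d) : (ℝ × Rd d) ≃ₜ (ℝ × Rd d) where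
  toFun p := (p.1, p.2 + p.1 • e)
  invFun p := (p.1, p.2 - p.1 • e)
  left_inv p := by simp
  right_inv p := by simp
  continuous_toFun := by fun_prop
  continuous_invFun := by fun_prop

lemma MeasureTheory.LocallyIntegrable.shear {d : ℕ} (e : Rd d) {h : Rd d → ℝ}
    (hh : LocallyIntegrable h volume) :
    LocallyIntegrable (fun p : ℝ × Rd d => h (p.2 + p.1 • e)) volume := by
  refine (locallyIntegrable_map_homeomorph (_root_.shear e)
    (f := fun p : ℝ × Rd d => h p.2) (μ := volume)).1 ?_
  rw [show Measure.map (_root_.shear e) volume = volume from (measurePreserving_shear e).map_eq]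
  exact locallyIntegrable_comp_snd hh

lemma MeasureTheory.LocallyIntegrable.integrable_shear {d : ℕ} (e : Rd d) {h : Rd d → ℝ}
    (hh : LocallyIntegrable h volume) (a b : ℝ) {K : Set (Rd d)} (hK : IsCompact K) :
    Integrable (fun p : ℝ × Rd d => h (p.2 + p.1 • e))
      ((volume.restrict (uIoc a b)).prod (volume.restrict K)) := by
  rw [Measure.prod_restrict]
  exact ((hh.shear e).integrableOn_isCompact (isCompact_uIcc.prod hK)).mono_set
    (prod_mono uIoc_subset_uIcc Subset.rfl)

lemma locallyIntegrable_integral_line {d : ℕ} (e : Rd d) {h : Rd d → ℝ}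
    (hh : LocallyIntegrable h volume) (t : ℝ) :
    LocallyIntegrable (fun x => ∫ r in 0..t, h (x + r • e)) volume := by
  rw [locallyIntegrable_iff]
  intro K hK
  simp_rw [intervalIntegral.intervalIntegral_eq_integral_uIoc]
  have h1 := (hh.integrable_shear e 0 t hK).integral_prod_right
  exact h1.smul (if 0 ≤ t then (1 : ℝ) else -1)

lemma ae_intervalIntegrable_line {d : ℕ} (e : Rd d) {h : Rd d → ℝ}
    (hh : LocallyIntegrable h volume) :
    ∀ᵐ x : Rd d, ∀ t, IntervalIntegrable (fun r => h (x + r • e)) volume 0 t := by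
  have key : ∀ n : ℕ, ∀ᵐ x : Rd d, x ∈ Metric.closedBall 0 (n : ℝ) →
      IntegrableOn (fun r => h (x + r • e)) (uIoc (-n : ℝ) n) := fun n =>
    (ae_restrict_iff' measurableSet_closedBall).1
      (hh.integrable_shear e (-n : ℝ) n (isCompact_closedBall 0 (n : ℝ))).prod_left_ae
  filter_upwards [ae_all_iff.2 key] with x hx t
  obtain ⟨n, hn⟩ := exists_nat_ge (max ‖x‖ |t|)
  have h1 := hx n (by simpa using (le_max_left _ _).trans hn)
  have h2 := abs_le.1 ((le_max_right _ _).trans hn)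
  refine (intervalIntegrable_iff.2 h1).mono_set (uIcc_subset_uIcc ?_ ?_) <;>
    rw [mem_uIcc] <;> left <;> constructor <;> linarith [h2.1, h2.2]

/-- The integral of `w` against the translate of `η` by `t e`. -/
def pairTranslate {d : ℕ} (e : Rd d) (η w : Rd d → ℝ) (t : ℝ) : ℝ :=
  ∫ x, w x * η (x - t • e)

lemma integral_translate_mul {d : ℕ} (e : Rd d) (η w : Rd d → ℝ) (t : ℝ) :
    ∫ x, η x * w (x + t • e) = pairTranslate e η w t := by
  rw [pairTranslate, ← integral_add_right_eq_self (fun x => w x * η (x - t • e)) (t • e)]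
  simp [mul_comm]

lemma integral_mul_integral_line {d : ℕ} (e : Rd d) {η v : Rd d → ℝ} (hη : Continuous η)
    (hηc : HasCompactSupport η) (hv : LocallyIntegrable v volume) (t : ℝ) :
    ∫ x, η x * ∫ r in 0..t, v (x + r • e) = ∫ r in 0..t, pairTranslate e η v r := by
  simp_rw [← integral_translate_mul]
  rw [intervalIntegral_integral_swap]
  · simp_rw [intervalIntegral.integral_const_mul]
  · have h1 : IntegrableOn (fun p : ℝ × Rd d => η p.2 * v (p.2 + p.1 • e))
        (uIcc 0 t ×ˢ tsupport η) :=
      ((hv.shear e).integrableOn_isCompact (isCompact_uIcc.prod hηc)).continuousOn_mul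
        (g := fun p : ℝ × Rd d => η p.2) (by fun_prop) (isCompact_uIcc.prod hηc)
    have h2 := (h1.mono_set (prod_mono uIoc_subset_uIcc Subset.rfl)).of_forall_sdiff_eq_zero
      (t := uIoc 0 t ×ˢ univ) (measurableSet_uIoc.prod .univ) (by
        rintro ⟨r, x⟩ ⟨⟨hr, -⟩, hx⟩
        have : x ∉ tsupport η := fun h => hx ⟨hr, h⟩
        simp [image_eq_zero_of_notMem_tsupport this])
    rw [IntegrableOn] at h2
    rw [← Measure.restrict_univ (μ := (volume : Measure (Rd d))), Measure.prod_restrict]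
    exact h2

lemma IsTest.pd {d : ℕ} {φ : Rd d → ℝ} (hφ : IsTest φ) (i : Fin d) : IsTest (pd i φ) := by
  refine ⟨?_, hφ.2.fderiv_apply ℝ _⟩
  exact (hφ.1.fderiv_right (m := (⊤ : ℕ∞)) (by simp)).clm_apply contDiff_const

lemma IsTest.mul {d : ℕ} {φ ψ : Rd d → ℝ} (hφ : IsTest φ) (hψ : IsTest ψ) :
    IsTest (fun x => φ x * ψ x) :=
  ⟨hφ.1.mul hψ.1, hφ.2.mul_right⟩

lemma IsTest.comp_sub {d : ℕ} {φ : Rd d → ℝ} (hφ : IsTest φ) (y : Rd d) :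
    IsTest (fun x => φ (x - y)) :=
  ⟨hφ.1.comp (contDiff_id.sub contDiff_const), hφ.2.comp_homeomorph (Homeomorph.subRight y)⟩

lemma IsTest.hasDerivAt_pairTranslate {d : ℕ} {η w : Rd d → ℝ} (hη : IsTest η)
    (hw : LocallyIntegrable w volume) (i : Fin d) (t : ℝ) :
    HasDerivAt (pairTranslate (EuclideanSpace.single i 1) η w)
      (-pairTranslate (EuclideanSpace.single i 1) (_root_.pd i η) w t) t := by
  set e : Rd d := EuclideanSpace.single i 1
  set θ : Rd d → ℝ := fun y => η (-y)
  have hθ : ContDiff ℝ (⊤ : ℕ∞) θ := hη.1.comp contDiff_neg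
  have hθc : HasCompactSupport θ := hη.2.comp_homeomorph (Homeomorph.neg _)
  have h1 := hθc.hasFDerivAt_convolution_right (ContinuousLinearMap.mul ℝ ℝ) hw
    (hθ.of_le (by simp)) (t • e)
  have h2 : HasDerivAt (fun s : ℝ => s • e) e t := by
    simpa using (hasDerivAt_id t).smul_const e
  have h3 := h1.comp_hasDerivAt t h2
  rw [convolution_precompR_apply _ hw (hθc.fderiv ℝ) (hθ.continuous_fderiv (by simp))] at h3
  have h4 : pairTranslate e η w = convolution w θ (ContinuousLinearMap.mul ℝ ℝ) ∘
      fun s : ℝ => s • e := by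
    ext s
    simp [pairTranslate, convolution, θ]
  have h5 : -pairTranslate e (_root_.pd i η) w t =
      convolution w (fun a => fderiv ℝ θ a e) (ContinuousLinearMap.mul ℝ ℝ) volume (t • e) := by
    rw [pairTranslate, convolution, ← integral_neg]
    congr 1
    ext x
    have : HasFDerivAt θ _ (t • e - x) :=
      (hη.1.differentiable (by simp) _).hasFDerivAt.comp _ (hasFDerivAt_id (t • e - x)).neg
    simp [this.fderiv, _root_.pd, e]
  rw [h4, h5]
  exact h3

lemma IsTest.continuous_pairTranslate {d : ℕ} {η w : Rd d → ℝ} (hη : IsTest η)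
    (hw : LocallyIntegrable w volume) (i : Fin d) :
    Continuous (pairTranslate (EuclideanSpace.single i 1) η w) :=
  continuous_iff_continuousAt.2 fun t => (hη.hasDerivAt_pairTranslate hw i t).continuousAt

lemma HasWeakPartialDeriv.ae_line {d : ℕ} {i : Fin d} {g h : Rd d → ℝ}
    (H : HasWeakPartialDeriv i g h) (t : ℝ) :
    ∀ᵐ x : Rd d, g (x + t • EuclideanSpace.single i 1)
      = g x + ∫ r in 0..t, h (x + r • EuclideanSpace.single i 1) := by
  obtain ⟨hg, hh, H⟩ := H
  set e : Rd d := EuclideanSpace.single i 1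
  have hgt : LocallyIntegrable (fun x => g (x + t • e)) volume := by
    refine (locallyIntegrable_map_homeomorph (Homeomorph.addRight (t • e))).1 ?_
    rwa [Homeomorph.coe_addRight, (measurePreserving_add_right volume (t • e)).map_eq]
  have hI := locallyIntegrable_integral_line e hh t
  refine ae_eq_of_integral_contDiff_smul_eq hgt (hg.add hI) fun η hη hηc => ?_
  have hT : IsTest η := ⟨hη, hηc⟩
  have hder : ∀ r, HasDerivAt (pairTranslate e η g) (pairTranslate e η h r) r := fun r => by
    convert hT.hasDerivAt_pairTranslate hg i r using 1
    have h1 := H _ (hT.comp_sub (r • e))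
    rw [pairTranslate, pairTranslate, ← neg_eq_iff_eq_neg, ← h1]
    simp [pd, fderiv_comp_sub, e]
  have hftc := intervalIntegral.integral_eq_sub_of_hasDerivAt (a := 0) (b := t)
    (fun r _ => hder r) ((hT.continuous_pairTranslate hh i).intervalIntegrable 0 t)
  have h2 := integral_mul_integral_line e hη.continuous hηc hh t
  simp only [smul_eq_mul, mul_add]
  rw [integral_translate_mul, integral_add, h2, hftc]
  · simp [pairTranslate, mul_comm]
  · exact hg.integrable_smul_left_of_hasCompactSupport hη.continuous hηc
  · exact hI.integrable_smul_left_of_hasCompactSupport hη.continuous hηc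

lemma hasWeakPartialDeriv_of_ae_line {d : ℕ} {i : Fin d} {g h : Rd d → ℝ}
    (hg : LocallyIntegrable g volume) (hh : LocallyIntegrable h volume)
    (H : ∀ᵐ t : ℝ, ∀ᵐ x : Rd d, g (x + t • EuclideanSpace.single i 1)
      = g x + ∫ r in 0..t, h (x + r • EuclideanSpace.single i 1)) :
    HasWeakPartialDeriv i g h := by
  refine ⟨hg, hh, fun η hη => ?_⟩
  set e : Rd d := EuclideanSpace.single i 1
  have hcont := hη.continuous_pairTranslate hh i
  have h1 : ∀ᵐ t : ℝ, pairTranslate e η g t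
      = pairTranslate e η g 0 + ∫ r in 0..t, pairTranslate e η h r := by
    filter_upwards [H] with t ht
    have hI := locallyIntegrable_integral_line e hh t
    rw [← integral_mul_integral_line e hη.1.continuous hη.2 hh, ← integral_translate_mul,
      ← integral_translate_mul, ← integral_add]
    · refine integral_congr_ae ?_
      filter_upwards [ht] with x hx
      rw [hx]
      simp [mul_add]
    · simpa using hg.integrable_smul_left_of_hasCompactSupport hη.1.continuous hη.2
    · exact hI.integrable_smul_left_of_hasCompactSupport hη.1.continuous hη.2
  have hder : ∀ t, HasDerivAt (fun t => ∫ r in 0..t, pairTranslate e η h r)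
      (pairTranslate e η h t) t := fun t =>
    intervalIntegral.integral_hasDerivAt_right (hcont.intervalIntegrable _ _)
      (hcont.stronglyMeasurableAtFilter _ _) hcont.continuousAt
  have h2 : pairTranslate e η g
      = fun t => pairTranslate e η g 0 + ∫ r in 0..t, pairTranslate e η h r :=
    (hη.continuous_pairTranslate hg i).ae_eq_iff_eq volume
      (continuous_const.add (continuous_iff_continuousAt.2 fun t => (hder t).continuousAt)) |>.1 h1
  have h3 := (hη.hasDerivAt_pairTranslate hg i 0).unique
    (((hder 0).const_add (pairTranslate e η g 0)).congr_of_eventuallyEq (.of_forall (congrFun h2)))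
  have h4 : pairTranslate e (pd i η) g 0 = -pairTranslate e η h 0 := by
    rw [← h3, neg_neg]
  simpa [pairTranslate] using h4

lemma measurableSet_line {d : ℕ} (e : Rd d) {g h : Rd d → ℝ} (hg : Measurable g)
    (hh : Measurable h) :
    MeasurableSet {p : ℝ × Rd d | g (p.2 + p.1 • e) = g p.2 + ∫ r in 0..p.1, h (p.2 + r • e)} := by
  have h1 : ∀ p : ℝ × Rd d, ∫ r in 0..p.1, h (p.2 + r • e)
      = p.1 * ∫ r in Ioc (0 : ℝ) 1, h (p.2 + (p.1 * r) • e) := fun p => by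
    rw [← intervalIntegral.integral_of_le zero_le_one,
      intervalIntegral.mul_integral_comp_mul_left (f := fun r => h (p.2 + r • e))]
    simp
  simp_rw [h1]
  have h2 : Measurable fun p : ℝ × Rd d => p.2 + p.1 • e :=
    Continuous.measurable (by fun_prop)
  have h3 : Measurable fun q : (ℝ × Rd d) × ℝ => q.1.2 + (q.1.1 * q.2) • e :=
    Continuous.measurable (by fun_prop)
  have h4 : Measurable fun p : ℝ × Rd d => ∫ r in Ioc (0 : ℝ) 1, h (p.2 + (p.1 * r) • e) :=
    (StronglyMeasurable.integral_prod_right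
      (f := fun (p : ℝ × Rd d) (r : ℝ) => h (p.2 + (p.1 * r) • e))
      (hh.comp h3).stronglyMeasurable).measurable
  exact measurableSet_eq_fun (hg.comp h2)
    ((hg.comp measurable_snd).add (measurable_fst.mul h4))

lemma mul_eq_of_ae_eq_primitive {f g h k : ℝ → ℝ} {f₀ g₀ : ℝ}
    (hh : ∀ t, IntervalIntegrable h volume 0 t) (hk : ∀ t, IntervalIntegrable k volume 0 t)
    (hf : ∀ᵐ t, f t = f₀ + ∫ r in 0..t, h r) (hg : ∀ᵐ t, g t = g₀ + ∫ r in 0..t, k r) :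
    ∀ᵐ t, f t * g t = f₀ * g₀ + ∫ r in 0..t, (h r * g r + f r * k r) := by
  filter_upwards [hf, hg] with t hft hgt
  have hF : ∀ {h : ℝ → ℝ} (c : ℝ), IntervalIntegrable h volume 0 t →
      AbsolutelyContinuousOnInterval (fun s => c + ∫ r in 0..s, h r) 0 t := fun {h} c hh => by
    have h1 := hh.absolutelyContinuousOnInterval_intervalIntegral (c := 0) (by simp)
    have h2 : AbsolutelyContinuousOnInterval (fun _ : ℝ => c) 0 t :=
      (LipschitzWith.const c).lipschitzOnWith.absolutelyContinuousOnInterval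
    exact h2.add h1
  have h1 := (hF f₀ (hh t)).integral_deriv_mul_eq_sub (hF g₀ (hk t))
  simp only [intervalIntegral.integral_same, add_zero, ← hft, ← hgt] at h1
  rw [← sub_eq_iff_eq_add', ← h1]
  refine intervalIntegral.integral_congr_ae ?_
  filter_upwards [hf, hg, (hh t).ae_hasDerivAt_integral, (hk t).ae_hasDerivAt_integral]
    with r hfr hgr hhr hkr hr
  have hr' := uIoc_subset_uIcc hr
  rw [((hhr hr' 0 (by simp)).const_add f₀).deriv, ((hkr hr' 0 (by simp)).const_add g₀).deriv,
    hfr, hgr]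

lemma HasWeakPartialDeriv.congr {d : ℕ} {i : Fin d} {g h g' h' : Rd d → ℝ}
    (H : HasWeakPartialDeriv i g h) (hg : g =ᵐ[volume] g') (hh : h =ᵐ[volume] h') :
    HasWeakPartialDeriv i g' h' := by
  refine ⟨H.1.congr hg, H.2.1.congr hh, fun φ hφ => ?_⟩
  have h1 : (fun x => g' x * pd i φ x) =ᵐ[volume] fun x => g x * pd i φ x := by
    filter_upwards [hg] with x hx
    rw [hx]
  have h2 : (fun x => h' x * φ x) =ᵐ[volume] fun x => h x * φ x := by
    filter_upwards [hh] with x hx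
    rw [hx]
  rw [integral_congr_ae h1, integral_congr_ae h2, H.2.2 φ hφ]

lemma HasWeakPartialDeriv.mul_of_measurable {d : ℕ} {i : Fin d} {f g h k : Rd d → ℝ}
    (Hf : HasWeakPartialDeriv i f h) (Hg : HasWeakPartialDeriv i g k)
    (mf : Measurable f) (mg : Measurable g) (mh : Measurable h) (mk : Measurable k)
    (hfg : LocallyIntegrable (fun x => f x * g x) volume)
    (hhk : LocallyIntegrable (fun x => h x * g x + f x * k x) volume) :
    HasWeakPartialDeriv i (fun x => f x * g x) (fun x => h x * g x + f x * k x) := by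
  refine hasWeakPartialDeriv_of_ae_line hfg hhk ?_
  have key := fun {g h : Rd d → ℝ} (H : HasWeakPartialDeriv i g h) (mg : Measurable g)
    (mh : Measurable h) => (Measure.ae_ae_comm (μ := (volume : Measure ℝ))
      (ν := (volume : Measure (Rd d)))
      (measurableSet_line (EuclideanSpace.single i 1) mg mh)).1 (.of_forall H.ae_line)
  refine (Measure.ae_ae_comm (measurableSet_line (EuclideanSpace.single i 1) (mf.mul mg)
    ((mh.mul mg).add (mf.mul mk)))).2 ?_
  filter_upwards [key Hf mf mh, key Hg mg mk,
    ae_intervalIntegrable_line (EuclideanSpace.single i 1) Hf.2.1,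
    ae_intervalIntegrable_line (EuclideanSpace.single i 1) Hg.2.1] with x h1 h2 h3 h4
  exact mul_eq_of_ae_eq_primitive h3 h4 h1 h2

/-- Leibniz rule for weak derivatives in `L¹_loc`, assuming only that the product and its formal
derivative are locally integrable. -/
lemma HasWeakPartialDeriv.mul {d : ℕ} {i : Fin d} {f g h k : Rd d → ℝ}
    (Hf : HasWeakPartialDeriv i f h) (Hg : HasWeakPartialDeriv i g k)
    (hfg : LocallyIntegrable (fun x => f x * g x) volume)
    (hhk : LocallyIntegrable (fun x => h x * g x + f x * k x) volume) :
    HasWeakPartialDeriv i (fun x => f x * g x) (fun x => h x * g x + f x * k x) := by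
  have mf := Hf.1.aestronglyMeasurable.aemeasurable
  have mg := Hg.1.aestronglyMeasurable.aemeasurable
  have mh := Hf.2.1.aestronglyMeasurable.aemeasurable
  have mk := Hg.2.1.aestronglyMeasurable.aemeasurable
  have e1 := mf.ae_eq_mk.mul mg.ae_eq_mk
  have e2 := (mh.ae_eq_mk.mul mg.ae_eq_mk).add (mf.ae_eq_mk.mul mk.ae_eq_mk)
  exact ((Hf.congr mf.ae_eq_mk mh.ae_eq_mk).mul_of_measurable (Hg.congr mg.ae_eq_mk mk.ae_eq_mk)
    mf.measurable_mk mg.measurable_mk mh.measurable_mk mk.measurable_mk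
    (hfg.congr e1) (hhk.congr e2)).congr e1.symm e2.symm

lemma MemL2loc.locallyIntegrable_sq_mul {d : ℕ} {ρ g : Rd d → ℝ}
    (hρ : LocallyIntegrable ρ volume) (hpos : ∀ᵐ x : Rd d, 0 < ρ x)
    (hgm : AEStronglyMeasurable g volume) (hg : MemL2loc (rhoMeasure ρ) g) :
    LocallyIntegrable (fun x => g x ^ 2 * ρ x) volume := by
  intro x
  have hR : 0 < ‖x‖ + 1 := by positivity
  refine ⟨Metric.ball 0 (‖x‖ + 1), Metric.isOpen_ball.mem_nhds (by simp), ?_⟩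
  have hρm := hρ.aestronglyMeasurable
  have h1 := hg _ hR
  rw [rhoMeasure, setLIntegral_withDensity_eq_lintegral_mul₀' hρm.aemeasurable.ennreal_ofReal
    ((hgm.aemeasurable.pow_const 2).ennreal_ofReal.mono_ac (withDensity_absolutelyContinuous _ _))
    measurableSet_ball] at h1
  refine ⟨((hgm.pow 2).mul hρm).restrict, ?_⟩
  rw [hasFiniteIntegral_iff_ofReal]
  · refine lt_of_eq_of_lt (lintegral_congr fun y => ?_) h1
    rw [Pi.mul_apply, mul_comm, ENNReal.ofReal_mul' (sq_nonneg _)]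
  · filter_upwards [ae_restrict_of_ae hpos] with y hy
    exact mul_nonneg (sq_nonneg _) hy.le

lemma MemL2loc.locallyIntegrable_mul {d : ℕ} {ρ g : Rd d → ℝ}
    (hρ : LocallyIntegrable ρ volume) (hpos : ∀ᵐ x : Rd d, 0 < ρ x)
    (hgm : AEStronglyMeasurable g volume) (hg : MemL2loc (rhoMeasure ρ) g) :
    LocallyIntegrable (fun x => g x * ρ x) volume := by
  refine ((hg.locallyIntegrable_sq_mul hρ hpos hgm).add hρ).mono
    (hgm.mul hρ.aestronglyMeasurable) ?_
  filter_upwards [hpos] with x hx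
  rw [Pi.add_apply, Real.norm_eq_abs, Real.norm_eq_abs, abs_mul, abs_of_pos hx]
  refine le_trans ?_ (le_abs_self _)
  nlinarith [sq_nonneg (|g x| - 1), sq_abs (g x), abs_nonneg (g x)]

lemma MemL2loc.locallyIntegrable_mul_sqrt {d : ℕ} {ρ g : Rd d → ℝ}
    (hρ : LocallyIntegrable ρ volume) (hpos : ∀ᵐ x : Rd d, 0 < ρ x)
    (hgm : AEStronglyMeasurable g volume) (hg : MemL2loc (rhoMeasure ρ) g) :
    LocallyIntegrable (fun x => g x * √(ρ x)) volume := by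
  refine ((hg.locallyIntegrable_sq_mul hρ hpos hgm).add (locallyIntegrable_const (1 : ℝ))).mono
    (hgm.mul (Real.continuous_sqrt.comp_aestronglyMeasurable hρ.aestronglyMeasurable)) ?_
  filter_upwards [hpos] with x hx
  rw [Pi.add_apply, Real.norm_eq_abs, Real.norm_eq_abs]
  have h1 : g x ^ 2 * ρ x = |g x * √(ρ x)| ^ 2 := by
    rw [sq_abs, mul_pow, Real.sq_sqrt hx.le]
  rw [h1]
  refine le_trans ?_ (le_abs_self _)
  nlinarith [sq_nonneg (|g x * √(ρ x)| - 1), abs_nonneg (g x * √(ρ x))]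

/-- If `√ρ` and `α` are weakly differentiable, with `α`, `∂ᵢα` and `α ∂ᵢ√ρ / √ρ` in `L²_loc(ρ dx)`,
then `αρ` is weakly differentiable with the expected derivative. -/
lemma HasWeakPartialDeriv.mul_density {d : ℕ} {i : Fin d} {ρ α α' s' : Rd d → ℝ}
    (hρ : LocallyIntegrable ρ volume) (hpos : ∀ᵐ x : Rd d, 0 < ρ x)
    (Hα : HasWeakPartialDeriv i α α') (Hs : HasWeakPartialDeriv i (fun x => √(ρ x)) s')
    (hα : MemL2loc (rhoMeasure ρ) α) (hα' : MemL2loc (rhoMeasure ρ) α')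
    (hαs : MemL2loc (rhoMeasure ρ) fun x => α x * (s' x / √(ρ x))) :
    HasWeakPartialDeriv i (fun x => α x * ρ x)
      (fun x => (α' x + 2 * (α x * (s' x / √(ρ x)))) * ρ x) := by
  have mα := Hα.1.aestronglyMeasurable
  have mα' := Hα.2.1.aestronglyMeasurable
  have mαs : AEStronglyMeasurable (fun x => α x * (s' x / √(ρ x))) volume :=
    mα.mul (Hs.2.1.aestronglyMeasurable.aemeasurable.div
      Hs.1.aestronglyMeasurable.aemeasurable).aestronglyMeasurable
  have e1 : (fun x => α' x * √(ρ x) + α x * (s' x / √(ρ x)) * √(ρ x))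
      =ᵐ[volume] fun x => α' x * √(ρ x) + α x * s' x := by
    filter_upwards [hpos] with x hx
    have := Real.sqrt_pos.2 hx
    field_simp
  have H1 := Hα.mul Hs (hα.locallyIntegrable_mul_sqrt hρ hpos mα)
    (((hα'.locallyIntegrable_mul_sqrt hρ hpos mα').add
      (hαs.locallyIntegrable_mul_sqrt hρ hpos mαs)).congr e1)
  have e2 : (fun x => α x * ρ x) =ᵐ[volume] fun x => α x * √(ρ x) * √(ρ x) := by
    filter_upwards [hpos] with x hx
    rw [mul_assoc, Real.mul_self_sqrt hx.le]
  have e3 : (fun x => (α' x + 2 * (α x * (s' x / √(ρ x)))) * ρ x) =ᵐ[volume]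
      fun x => (α' x * √(ρ x) + α x * s' x) * √(ρ x) + α x * √(ρ x) * s' x := by
    filter_upwards [hpos] with x hx
    have h0 := Real.sqrt_pos.2 hx
    have h1 := Real.mul_self_sqrt hx.le
    generalize √(ρ x) = s at h0 h1
    rw [← h1]
    field_simp
    ring
  have e4 : (fun x => α' x * ρ x + (α x * (s' x / √(ρ x)) * ρ x + α x * (s' x / √(ρ x)) * ρ x))
      = fun x => (α' x + 2 * (α x * (s' x / √(ρ x)))) * ρ x := by
    ext x
    ring
  have l1 := hαs.locallyIntegrable_mul hρ hpos mαs
  have l2 := (hα'.locallyIntegrable_mul hρ hpos mα').add (l1.add l1)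
  exact (H1.mul Hs ((hα.locallyIntegrable_mul hρ hpos mα).congr e2)
    ((l2.congr (.of_forall (congrFun e4))).congr e3)).congr e2.symm e3.symm

lemma pd_mul {d : ℕ} {φ ψ : Rd d → ℝ} (hφ : IsTest φ) (hψ : IsTest ψ) (i : Fin d) (x : Rd d) :
    pd i (fun y => φ y * ψ y) x = pd i φ x * ψ x + φ x * pd i ψ x := by
  rw [pd, fderiv_fun_mul (hφ.1.differentiable (by simp) x) (hψ.1.differentiable (by simp) x)]
  simp [pd]
  ring

lemma MeasureTheory.LocallyIntegrable.mul_isTest {d : ℕ} {w η : Rd d → ℝ}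
    (hw : LocallyIntegrable w volume) (hη : IsTest η) :
    Integrable (fun x => w x * η x) volume := by
  simpa [mul_comm] using hw.integrable_smul_left_of_hasCompactSupport hη.1.continuous hη.2

lemma integral_mul_L0A {d : ℕ} {ρ : Rd d → ℝ} (hρ : LocallyIntegrable ρ volume)
    (hpos : ∀ᵐ x : Rd d, 0 < ρ x) {a : Fin d → Fin d → Rd d → ℝ}
    {da : Fin d → Fin d → Fin d → Rd d → ℝ} {c : Rd d → ℝ} {dsq : Fin d → Rd d → ℝ}
    (hA : AssumptionA a da c ρ dsq) {φ ψ : Rd d → ℝ} (hφ : IsTest φ) (hψ : IsTest ψ) :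
    ∫ x, ψ x * L0A a da c ρ dsq φ x * ρ x
      = -(∫ x, (∑ i, ∑ j, a i j x * pd i ψ x * pd j φ x) * ρ x)
        + ∫ x, c x * ψ x * φ x * ρ x := by
  obtain ⟨-, hcm, -, -, -, hda, haL, hcL, hdaL, hs, hsL⟩ := hA
  have W : ∀ i j, HasWeakPartialDeriv i (fun x => a i j x * ρ x)
      (fun x => (da i j i x + 2 * (a i j x * (dsq i x / √(ρ x)))) * ρ x) := fun i j =>
    (hda i j i).mul_density hρ hpos (hs i) (haL i j) (hdaL i j) (hsL i j)
  set V : Fin d → Fin d → Rd d → ℝ := fun i j x =>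
    (da i j i x + 2 * (a i j x * (dsq i x / √(ρ x)))) * ρ x with hV
  set T : Fin d → Rd d → ℝ := fun j x => ψ x * pd j φ x with hT
  have tT : ∀ j, IsTest (T j) := fun j => hψ.mul (hφ.pd j)
  have i1 : ∀ i j, Integrable (fun x => a i j x * ρ x * pd i (T j) x) := fun i j =>
    (W i j).1.mul_isTest ((tT j).pd i)
  have i2 : ∀ i j, Integrable (fun x => V i j x * T j x) := fun i j =>
    (W i j).2.1.mul_isTest (tT j)
  have i3 : ∀ i j, Integrable (fun x => a i j x * ρ x * (pd i ψ x * pd j φ x)) := fun i j =>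
    (W i j).1.mul_isTest ((hψ.pd i).mul (hφ.pd j))
  have i4 : Integrable (fun x => c x * ρ x * (ψ x * φ x)) :=
    (hcL.locallyIntegrable_mul hρ hpos hcm.aestronglyMeasurable).mul_isTest (hψ.mul hφ)
  have i12 : ∀ i j, Integrable (fun x => a i j x * ρ x * pd i (T j) x + V i j x * T j x) :=
    fun i j => (i1 i j).add (i2 i j)
  have z : ∀ i j, ∫ x, (a i j x * ρ x * pd i (T j) x + V i j x * T j x) = 0 := fun i j => by
    rw [integral_add (i1 i j) (i2 i j), (W i j).2.2 _ (tT j), neg_add_cancel]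
  have e1 : ∀ x, ψ x * L0A a da c ρ dsq φ x * ρ x
      = ∑ i, ∑ j, (a i j x * ρ x * pd i (T j) x + V i j x * T j x)
        - ∑ i, ∑ j, a i j x * ρ x * (pd i ψ x * pd j φ x) + c x * ρ x * (ψ x * φ x) := fun x => by
    have h1 : ∀ i j, pd i (T j) x = pd i ψ x * pd j φ x + ψ x * pd2 i j φ x := fun i j =>
      pd_mul hψ (hφ.pd j) i x
    simp only [L0A, mul_add, add_mul, Finset.mul_sum, Finset.sum_mul, ← Finset.sum_add_distrib,
      ← Finset.sum_sub_distrib]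
    congr 1
    · refine Finset.sum_congr rfl fun i _ => Finset.sum_congr rfl fun j _ => ?_
      rw [h1]
      simp only [hV, hT]
      ring
    · ring
  have e2 : ∀ x, (∑ i, ∑ j, a i j x * pd i ψ x * pd j φ x) * ρ x
      = ∑ i, ∑ j, a i j x * ρ x * (pd i ψ x * pd j φ x) := fun x => by
    simp only [Finset.sum_mul]
    refine Finset.sum_congr rfl fun i _ => Finset.sum_congr rfl fun j _ => ?_
    ring
  have e3 : ∀ x, c x * ψ x * φ x * ρ x = c x * ρ x * (ψ x * φ x) := fun x => by ring
  have j1 : Integrable (fun x => ∑ i, ∑ j,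
      (a i j x * ρ x * pd i (T j) x + V i j x * T j x)) :=
    integrable_finsetSum _ fun i _ => integrable_finsetSum _ fun j _ => i12 i j
  have j3 : Integrable (fun x => ∑ i, ∑ j, a i j x * ρ x * (pd i ψ x * pd j φ x)) :=
    integrable_finsetSum _ fun i _ => integrable_finsetSum _ fun j _ => i3 i j
  have z' : ∫ x, ∑ i, ∑ j, (a i j x * ρ x * pd i (T j) x + V i j x * T j x) = 0 := by
    rw [integral_finsetSum _ fun i _ =>
      integrable_finsetSum _ fun j _ => i12 i j]
    refine Finset.sum_eq_zero fun i _ => ?_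
    rw [integral_finsetSum _ fun j _ => i12 i j]
    exact Finset.sum_eq_zero fun j _ => z i j
  simp_rw [e1, e2, e3]
  rw [integral_add (by exact j1.sub j3) i4, integral_sub j1 j3, z', zero_sub]

/-- Under assumption (A), for all test functions `φ, ψ`:
`∫ ψ (L₀φ) ρ dx = −∫ ⟨A∇ψ, ∇φ⟩ ρ dx + ∫ c ψ φ ρ dx`; in particular `L₀` is symmetric on
`L²(ρ dx)` and `−∫ φ (L₀φ) ρ dx ≥ 0`. -/
theorem assumptionA_symmetric_preDirichlet
    {d : ℕ} (ρ : Rd d → ℝ)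
    (hρloc : LocallyIntegrable ρ volume)
    (hρpos : ∀ᵐ x ∂(volume : Measure (Rd d)), 0 < ρ x)
    (a : Fin d → Fin d → Rd d → ℝ) (da : Fin d → Fin d → Fin d → Rd d → ℝ)
    (c : Rd d → ℝ) (dsq : Fin d → Rd d → ℝ)
    (hA : AssumptionA a da c ρ dsq) :
    ∀ φ ψ : Rd d → ℝ, IsTest φ → IsTest ψ →
      (∫ x, ψ x * L0A a da c ρ dsq φ x * ρ x
        = -(∫ x, (∑ i, ∑ j, a i j x * pd i ψ x * pd j φ x) * ρ x)
          + ∫ x, c x * ψ x * φ x * ρ x) ∧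
      (∫ x, ψ x * L0A a da c ρ dsq φ x * ρ x
        = ∫ x, φ x * L0A a da c ρ dsq ψ x * ρ x) ∧
      0 ≤ -(∫ x, φ x * L0A a da c ρ dsq φ x * ρ x) := by
  intro φ ψ hφ hψ
  have key := fun {φ ψ : Rd d → ℝ} (hφ : IsTest φ) (hψ : IsTest ψ) =>
    integral_mul_L0A hρloc hρpos hA hφ hψ
  obtain ⟨-, -, hc, hsymm, hnonneg, -⟩ := hA
  refine ⟨key hφ hψ, ?_, ?_⟩
  · rw [key hφ hψ, key hψ hφ]
    congr 2
    · congr 1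
      ext x
      rw [Finset.sum_comm]
      congr 1
      refine Finset.sum_congr rfl fun i _ => Finset.sum_congr rfl fun j _ => ?_
      rw [hsymm j i x]
      ring
    · ext x
      ring
  · rw [key hφ hφ, neg_add, neg_neg, ← integral_neg]
    refine add_nonneg (integral_nonneg_of_ae ?_) (integral_nonneg_of_ae ?_)
    · filter_upwards [hρpos] with x hx
      refine mul_nonneg ((hnonneg x fun i => pd i φ x).trans_eq ?_) hx.le
      refine Finset.sum_congr rfl fun i _ => Finset.sum_congr rfl fun j _ => ?_
      ring
    · filter_upwards [hρpos] with x hx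
      have h1 : 0 ≤ -c x * (φ x * φ x) * ρ x :=
        mul_nonneg (mul_nonneg (neg_nonneg.2 (hc x)) (mul_self_nonneg _)) hx.le
      simp only [Pi.zero_apply]
      linarith

end
end
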